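/- Let S be a semigroup and let R be an S-graded ring which is graded von Neumann regular. Then (i) R_e is a von Neumann regular ring for every e ∈ E(S), and (ii) R is nearly epsilon-strongly S-graded. -/

import Mathlib

open scoped Pointwise

/-- The set `E(S)` of idempotent elements of a semigroup `S`. -/
def idempotentSet (S : Type*) [Semigroup S] : Set S := {s | s * s = s}

/-- The set `V(s) = {t ∈ S ∣ sts = s and tst = t}`. -/
def invSet {S : Type*} [Semigroup S] (s : S) : Set S :=
  {t | s * t * s = s ∧ t * s * t = t}

/-- The product `A B` of two additive subgroups of a ring: the additive subgroup
generated by all products `a * b` with `a ∈ A`, `b ∈ B`. -/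
def subgroupMul {R : Type*} [NonUnitalRing R] (A B : AddSubgroup R) : AddSubgroup R :=
  AddSubgroup.closure ((A : Set R) * (B : Set R))

/-- `R` is an `S`-graded ring via the family `𝒜` of additive subgroups:
`R = ⊕_{s ∈ S} R_s` (internal direct sum) and `R_s R_t ⊆ R_{st}`. -/
structure IsSemigroupGrading {S R : Type*} [Semigroup S] [DecidableEq S] [NonUnitalRing R]
    (𝒜 : S → AddSubgroup R) : Prop where
  internal : DirectSum.IsInternal 𝒜
  mul_mem : ∀ s t : S, ∀ a ∈ 𝒜 s, ∀ b ∈ 𝒜 t, a * b ∈ 𝒜 (s * t)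

/-- `R` is symmetrically `S`-graded: `R_s = R_s R_t R_s` for all `s ∈ S`, `t ∈ V(s)`. -/
def SymmetricallyGraded {S R : Type*} [Semigroup S] [NonUnitalRing R]
    (𝒜 : S → AddSubgroup R) : Prop :=
  ∀ s : S, ∀ t ∈ invSet s, 𝒜 s = subgroupMul (subgroupMul (𝒜 s) (𝒜 t)) (𝒜 s)

/-- A subset `P` of `R` (closed under multiplication) is a unital ring:
it has a two-sided multiplicative identity element. -/
def HasUnity {R : Type*} [NonUnitalRing R] (P : AddSubgroup R) : Prop :=
  ∃ u ∈ P, ∀ x ∈ P, u * x = x ∧ x * u = x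

/-- A subset `P` of `R` is an s-unital ring: `x ∈ Px` and `x ∈ xP` for every `x ∈ P`. -/
def IsSUnital {R : Type*} [NonUnitalRing R] (P : AddSubgroup R) : Prop :=
  ∀ x ∈ P, (∃ u ∈ P, u * x = x) ∧ (∃ v ∈ P, x * v = x)

/-- A subset `P` of `R` is a von Neumann regular ring: `r ∈ rPr` for every `r ∈ P`. -/
def IsVonNeumannRegular {R : Type*} [NonUnitalRing R] (P : AddSubgroup R) : Prop :=
  ∀ r ∈ P, ∃ x ∈ P, r = r * x * r

/-- `R` is epsilon-strongly `S`-graded. -/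
def EpsilonStronglyGraded {S R : Type*} [Semigroup S] [NonUnitalRing R]
    (𝒜 : S → AddSubgroup R) : Prop :=
  SymmetricallyGraded 𝒜 ∧ ∀ s : S, ∀ t ∈ invSet s, HasUnity (subgroupMul (𝒜 s) (𝒜 t))

/-- `R` is nearly epsilon-strongly `S`-graded. -/
def NearlyEpsilonStronglyGraded {S R : Type*} [Semigroup S] [NonUnitalRing R]
    (𝒜 : S → AddSubgroup R) : Prop :=
  SymmetricallyGraded 𝒜 ∧ ∀ s : S, ∀ t ∈ invSet s, IsSUnital (subgroupMul (𝒜 s) (𝒜 t))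

/-- `R` is strongly `S`-graded: `R_s R_t = R_{st}` for all `s, t ∈ S`. -/
def StronglyGraded {S R : Type*} [Semigroup S] [NonUnitalRing R]
    (𝒜 : S → AddSubgroup R) : Prop :=
  ∀ s t : S, subgroupMul (𝒜 s) (𝒜 t) = 𝒜 (s * t)

/-- `R` is graded von Neumann regular: for all `s ∈ S`, `r ∈ R_s` and `t ∈ V(s)`,
there is `y ∈ R_t` with `r = ryr`. -/
def GradedVonNeumannRegular {S R : Type*} [Semigroup S] [NonUnitalRing R]
    (𝒜 : S → AddSubgroup R) : Prop :=
  ∀ s : S, ∀ r ∈ 𝒜 s, ∀ t ∈ invSet s, ∃ y ∈ 𝒜 t, r = r * y * r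

/-- Products of elements lie in the product of the subgroups. -/
theorem mul_mem_subgroupMul {R : Type*} [NonUnitalRing R] {A B : AddSubgroup R} {a b : R}
    (ha : a ∈ A) (hb : b ∈ B) : a * b ∈ subgroupMul A B :=
  AddSubgroup.subset_closure (Set.mul_mem_mul ha hb)

theorem subgroupMul_le {R : Type*} [NonUnitalRing R] {A B C : AddSubgroup R} :
    subgroupMul A B ≤ C ↔ ∀ a ∈ A, ∀ b ∈ B, a * b ∈ C := by
  rw [subgroupMul, AddSubgroup.closure_le]
  exact Set.mul_subset_iff

/-- A product of subgroups absorbs right multiplication by `y` when its right factor does. -/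
theorem mul_mem_subgroupMul_of_right {R : Type*} [NonUnitalRing R] {A B : AddSubgroup R}
    {y : R} (hy : ∀ b ∈ B, b * y ∈ B) {x : R} (hx : x ∈ subgroupMul A B) :
    x * y ∈ subgroupMul A B := by
  have h : subgroupMul A B ≤ (subgroupMul A B).comap (AddMonoidHom.mulRight y) := by
    refine subgroupMul_le.2 fun a ha b hb => ?_
    simpa [mul_assoc] using mul_mem_subgroupMul ha (hy b hb)
  exact h hx

/-- A product of subgroups absorbs left multiplication by `y` when its left factor does. -/
theorem mul_mem_subgroupMul_of_left {R : Type*} [NonUnitalRing R] {A B : AddSubgroup R}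
    {y : R} (hy : ∀ a ∈ A, y * a ∈ A) {x : R} (hx : x ∈ subgroupMul A B) :
    y * x ∈ subgroupMul A B := by
  have h : subgroupMul A B ≤ (subgroupMul A B).comap (AddMonoidHom.mulLeft y) := by
    refine subgroupMul_le.2 fun a ha b hb => ?_
    simpa [mul_assoc] using mul_mem_subgroupMul (hy a ha) hb
  exact h hx

theorem mem_invSet_self {S : Type*} [Semigroup S] {e : S} (he : e ∈ idempotentSet S) :
    e ∈ invSet e := by
  have h : e * e = e := he
  simp [invSet, h]

theorem mul_mem_idempotentSet {S : Type*} [Semigroup S] {s t : S} (ht : t ∈ invSet s) :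
    s * t ∈ idempotentSet S := by
  change s * t * (s * t) = s * t
  rw [← mul_assoc, ht.1]

/-- **Lemma (necessary conditions).** If `R` is an `S`-graded ring which is graded von
Neumann regular, then (i) `R_e` is von Neumann regular for every `e ∈ E(S)`, and
(ii) `R` is nearly epsilon-strongly `S`-graded. -/
theorem vonNeumannRegular_components_and_nearlyEpsilonStrong_of_gradedVonNeumannRegular
    {S R : Type*} [Semigroup S] [DecidableEq S] [NonUnitalRing R]
    (𝒜 : S → AddSubgroup R) (hgr : IsSemigroupGrading 𝒜)
    (hreg : GradedVonNeumannRegular 𝒜) :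
    (∀ e ∈ idempotentSet S, IsVonNeumannRegular (𝒜 e)) ∧
      NearlyEpsilonStronglyGraded 𝒜 := by
  have hmul := hgr.mul_mem
  have hidem : ∀ e ∈ idempotentSet S, IsVonNeumannRegular (𝒜 e) := fun e he r hr =>
    hreg e r hr e (mem_invSet_self he)
  have hle : ∀ s t, subgroupMul (𝒜 s) (𝒜 t) ≤ 𝒜 (s * t) := fun s t =>
    subgroupMul_le.2 (hmul s t)
  refine ⟨hidem, fun s t ht => le_antisymm (fun r hr => ?_) ?_, fun s t ht x hx => ?_⟩
  · obtain ⟨y, hy, hryr⟩ := hreg s r hr t ht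
    rw [hryr]
    exact mul_mem_subgroupMul (mul_mem_subgroupMul hr hy) hr
  · refine subgroupMul_le.2 fun a ha b hb => ?_
    simpa only [ht.1] using hmul _ _ a (hle s t ha) b hb
  · obtain ⟨y, hy, hxyx⟩ := hidem _ (mul_mem_idempotentSet ht) x (hle s t hx)
    refine ⟨⟨x * y, mul_mem_subgroupMul_of_right (fun b hb => ?_) hx, hxyx.symm⟩,
      ⟨y * x, mul_mem_subgroupMul_of_left (fun a ha => ?_) hx, ?_⟩⟩
    · simpa only [← mul_assoc, ht.2] using hmul _ _ b hb y hy
    · simpa only [ht.1] using hmul _ _ y hy a ha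
    · rw [← mul_assoc, ← hxyx]
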